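/- Let L be a commutative incline, i.e., L carries a SemilatticeSup structure and a CommSemigroup multiplication satisfying x*(y ⊔ z) = x*y ⊔ x*z and x ⊔ x*y = x for all x, y, z ∈ L. For a matrix A : Fin 3 → Fin 3 → L with powers defined entrywise by (A^m)_{ij} = the supremum over all walks V : Fin (m+1) → Fin 3 with V 0 = i, V m = j of ∏_{s=0}^{m-1} A (V s) (V (s+1)), the order-index of A is at most 5: there exists a positive integer k ≤ 5 (namely k = 5) and a positive integer d (namely d = 6) such that A^{k+d} ≤ A^k entrywise. -/

import Mathlib

/-- The product of the entries of a matrix `A` along a walk of positive length `l + 1`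
on `Fin n` (a walk of length `l + 1` being a function `Fin (l + 2) → Fin n`). -/
def walkProd {L : Type*} [Mul L] {n : ℕ} (A : Fin n → Fin n → L) :
    {l : ℕ} → (Fin (l + 2) → Fin n) → L
  | 0, V => A (V 0) (V 1)
  | l + 1, V => A (V 0) (V 1) * walkProd A (fun t : Fin (l + 2) => V t.succ)

/-- The `(i, j)` entry of the `(m + 1)`-st power of the matrix `A` over a semilattice:
the (finite, nonempty) supremum, over all walks `V` of length `m + 1` on `Fin 3`
with `V 0 = i` and `V (m + 1) = j`, of the product of the entries of `A` along `V`. -/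
def powEntry {L : Type*} [SemilatticeSup L] [Mul L]
    (A : Fin 3 → Fin 3 → L) (m : ℕ) (i j : Fin 3) : L :=
  Finset.sup'
    (Finset.univ.filter fun V : Fin (m + 2) → Fin 3 => V 0 = i ∧ V (Fin.last (m + 1)) = j)
    ⟨fun t => if t = 0 then i else j, by
      simp only [Finset.mem_filter, Finset.mem_univ, true_and]
      constructor
      · simp
      · rw [if_neg (by simp [Fin.ext_iff])]⟩
    (fun V => walkProd A V)

/-- `WalkWeight A m i j w` says that `w` is the product of the entries of `A` along some walk of
length `m` from `i` to `j`, the empty walk having weight `1`. -/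
def WalkWeight {L : Type*} [CommSemigroup L] {n : ℕ} (A : Fin n → Fin n → L) :
    ℕ → Fin n → Fin n → WithOne L → Prop
  | 0, i, j, w => i = j ∧ w = 1
  | m + 1, i, j, w => ∃ k u, WalkWeight A m k j u ∧ w = A i k * u

/-- The product of the entries of `A` over a list of edges. -/
def edgeWeight {L : Type*} [CommSemigroup L] {n : ℕ} (A : Fin n → Fin n → L)
    (l : List (Fin n × Fin n)) : WithOne L :=
  (l.map fun e => (A e.1 e.2 : WithOne L)).prod

/-- Whether some walk of length `m` from `i` to `j` uses only edges from `l`,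
counted with multiplicity. -/
def hasSubwalk {n : ℕ} (j : Fin n) : ℕ → Fin n → List (Fin n × Fin n) → Bool
  | 0, i, _ => i == j
  | m + 1, i, l => (List.finRange n).any fun k =>
      l.contains (i, k) && hasSubwalk j m k (l.erase (i, k))

/-- Given the list `l` of edges of a walk from `i` to `v`, checks that every extension of it by
`m` further edges has an initial segment, at least as long as `l`,
whose edges contain those of a walk with the same ends that is shorter by `d`. -/
def shortens {n : ℕ} (d : ℕ) (i : Fin n) : ℕ → Fin n → List (Fin n × Fin n) → Bool
  | 0, v, l => d.ble l.length && hasSubwalk v (l.length - d) i l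
  | m + 1, v, l => (d.ble l.length && hasSubwalk v (l.length - d) i l) ||
      (List.finRange n).all fun k => shortens d i m k ((v, k) :: l)

theorem shortens_six_five (i : Fin 3) : shortens 6 i 11 i [] = true := by
  decide +kernel +revert

section WalkWeight

variable {L : Type*} [CommSemigroup L] {n : ℕ} {A : Fin n → Fin n → L}

theorem WalkWeight.append {m p : ℕ} {i j k : Fin n} {u w : WithOne L}
    (hu : WalkWeight A m i k u) (hw : WalkWeight A p k j w) :
    WalkWeight A (m + p) i j (u * w) := by
  induction m generalizing i u with
  | zero =>
    obtain ⟨rfl, rfl⟩ := hu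
    simpa using hw
  | succ m ih =>
    obtain ⟨k', u', hu', rfl⟩ := hu
    rw [Nat.add_right_comm]
    exact ⟨k', u' * w, ih hu', mul_assoc _ _ _⟩

theorem walkWeight_walkProd {m : ℕ} (V : Fin (m + 2) → Fin n) :
    WalkWeight A (m + 1) (V 0) (V (Fin.last (m + 1))) (walkProd A V : L) := by
  induction m with
  | zero => exact ⟨V 1, 1, ⟨rfl, rfl⟩, (mul_one _).symm⟩
  | succ m ih =>
    exact ⟨V 1, _, ih fun t => V t.succ, WithOne.coe_mul _ _⟩

theorem WalkWeight.exists_walkProd {m : ℕ} {i j : Fin n} {w : WithOne L}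
    (h : WalkWeight A (m + 1) i j w) :
    ∃ V : Fin (m + 2) → Fin n, V 0 = i ∧ V (Fin.last (m + 1)) = j ∧ w = (walkProd A V : L) := by
  induction m generalizing i w with
  | zero =>
    obtain ⟨k, _, ⟨rfl, rfl⟩, rfl⟩ := h
    exact ⟨![i, k], rfl, rfl, mul_one _⟩
  | succ m ih =>
    obtain ⟨k, u, hu, rfl⟩ := h
    obtain ⟨V, rfl, hj, rfl⟩ := ih hu
    exact ⟨Fin.cons i V, rfl, hj, (WithOne.coe_mul _ _).symm⟩

theorem exists_walkWeight_dvd_of_hasSubwalk {m : ℕ} {i j : Fin n} {l : List (Fin n × Fin n)}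
    (h : hasSubwalk j m i l = true) : ∃ u, WalkWeight A m i j u ∧ u ∣ edgeWeight A l := by
  induction m generalizing i l with
  | zero => exact ⟨1, ⟨by simpa [hasSubwalk] using h, rfl⟩, one_dvd _⟩
  | succ m ih =>
    simp only [hasSubwalk, List.any_eq_true, Bool.and_eq_true, List.contains_iff_mem] at h
    obtain ⟨k, -, hmem, hk⟩ := h
    obtain ⟨u, hu, hdvd⟩ := ih hk
    refine ⟨A i k * u, ⟨k, u, hu, rfl⟩, ?_⟩
    rw [edgeWeight, ((List.perm_cons_erase hmem).map _).prod_eq]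
    rw [List.map_cons, List.prod_cons]
    exact mul_dvd_mul_left _ hdvd

theorem exists_walkWeight_dvd_of_shortens {d m : ℕ} {i v j : Fin n} {l : List (Fin n × Fin n)}
    {w : WithOne L} (h : shortens d i m v l = true) (hw : WalkWeight A m v j w) :
    ∃ u, WalkWeight A (l.length + m - d) i j u ∧ u ∣ edgeWeight A l * w := by
  have extend_subwalk {m : ℕ} {v : Fin n} {l : List (Fin n × Fin n)} {w : WithOne L}
      (h : (d.ble l.length && hasSubwalk v (l.length - d) i l) = true)
      (hw : WalkWeight A m v j w) :
      ∃ u, WalkWeight A (l.length + m - d) i j u ∧ u ∣ edgeWeight A l * w := by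
    rw [Bool.and_eq_true, Nat.ble_eq] at h
    obtain ⟨u, hu, hdvd⟩ := exists_walkWeight_dvd_of_hasSubwalk (A := A) h.2
    rw [Nat.sub_add_comm h.1]
    exact ⟨u * w, hu.append hw, mul_dvd_mul_right hdvd w⟩
  induction m generalizing v l w with
  | zero => exact extend_subwalk h hw
  | succ m ih =>
    rw [shortens, Bool.or_eq_true, List.all_eq_true] at h
    refine h.elim (extend_subwalk · hw) fun h => ?_
    obtain ⟨k, u, hu, rfl⟩ := hw
    obtain ⟨u', hu', hdvd⟩ := ih (h k (List.mem_finRange k)) hu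
    refine ⟨u', ?_, ?_⟩
    · rwa [List.length_cons, Nat.succ_add_eq_add_succ] at hu'
    · rwa [edgeWeight, List.map_cons, List.prod_cons, mul_comm (A v k : WithOne L),
        mul_assoc] at hdvd

end WalkWeight

theorem le_of_coe_dvd_coe {L : Type*} [SemilatticeSup L] [CommSemigroup L]
    (habs : ∀ x y : L, x ⊔ x * y = x) {x y : L} (h : (x : WithOne L) ∣ y) : y ≤ x := by
  obtain ⟨c, hc⟩ := h
  induction c with
  | one => exact (WithOne.coe_inj.mp (hc.trans (mul_one _))).le
  | coe c =>
    rw [WithOne.coe_inj.mp (hc.trans (WithOne.coe_mul x c).symm)]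
    exact sup_eq_left.mp (habs x c)


/-- The order-index of any `3 × 3` matrix `A` over a commutative incline
is at most 5: there are positive integers `k ≤ 5` and `d` with `A^(k+d) ≤ A^k` entrywise
(here `A^m = powEntry A (m - 1)` for `m ≥ 1`). -/
theorem order_index_le_five
    {L : Type*} [SemilatticeSup L] [CommSemigroup L]
    (hdist : ∀ x y z : L, x * (y ⊔ z) = x * y ⊔ x * z)
    (habs : ∀ x y : L, x ⊔ x * y = x)
    (A : Fin 3 → Fin 3 → L) :
    ∃ k : ℕ, 0 < k ∧ k ≤ 5 ∧ ∃ d : ℕ, 0 < d ∧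
      ∀ i j : Fin 3, powEntry A (k + d - 1) i j ≤ powEntry A (k - 1) i j := by
  refine ⟨5, by norm_num, le_rfl, 6, by norm_num, fun i j => Finset.sup'_le _ _ fun V hV => ?_⟩
  obtain ⟨hi, hj⟩ := (Finset.mem_filter.mp hV).2
  have hw : WalkWeight A 11 i j (walkProd A V : L) := hi ▸ hj ▸ walkWeight_walkProd V
  obtain ⟨u, hu, hdvd⟩ := exists_walkWeight_dvd_of_shortens (shortens_six_five i) hw
  obtain ⟨W, hWi, hWj, rfl⟩ := hu.exists_walkProd (m := 4)
  refine (le_of_coe_dvd_coe habs (by simpa [edgeWeight] using hdvd)).trans ?_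
  exact Finset.le_sup' (walkProd A) (Finset.mem_filter.mpr ⟨Finset.mem_univ W, hWi, hWj⟩)
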